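/- Let m ≥ 2 and let φ be a Schwartz function on ℝ, not identically zero, whose Fourier transform φ̂ is supported in [−1/100, 1/100]. For an integer N, let c_l = 1 if 9N/10 ≤ l ≤ 11N/10 and c_l = 0 otherwise, and let A_l = card{(j₁,…,j_m) ∈ {1,…,N}^m : j₁ + ⋯ + j_m = l}. For t ∈ [0,1] define F_{N,t}(x) = N^{−m} φ(x/N)^m Σ_{l=m}^{mN} a_l(t) c_l A_l e^{2πi l x/N}, where a_l are the Rademacher functions. Then for every 0 < p < ∞ there exist constants c, C > 0 depending only on p, m and φ such that for all sufficiently large N: c·N^{1−p/2} ≤ ∫₀¹ ∫_ℝ |F_{N,t}(x)|^p dx dt ≤ C·N^{1−p/2}. -/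

import Mathlib

open MeasureTheory

noncomputable section

/-- The Rademacher functions `a_j(t) = sign(sin(2^j π t))`. -/
def rademacher (j : ℕ) (t : ℝ) : ℝ := Real.sign (Real.sin (2 ^ j * Real.pi * t))

/-- The one-dimensional Fourier transform `f̂(ξ) = ∫ f(y) e^{-2πi yξ} dy`. -/
def ft1 (f : ℝ → ℂ) (ξ : ℝ) : ℂ :=
  ∫ y : ℝ, f y * Complex.exp (-(2 * Real.pi * Complex.I) * ((y * ξ : ℝ) : ℂ))

/-- The coefficient `c_l`: `1` if `9N/10 ≤ l ≤ 11N/10` and `0` otherwise. -/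
def cN (N : ℕ) (l : ℕ) : ℝ :=
  if 9 * (N : ℝ) / 10 ≤ (l : ℝ) ∧ (l : ℝ) ≤ 11 * (N : ℝ) / 10 then 1 else 0

/-- `A_l = card{(j₁,…,j_m) ∈ {1,…,N}^m : j₁ + ⋯ + j_m = l}`. -/
def ANm (m N : ℕ) (l : ℕ) : ℕ :=
  ((Fintype.piFinset fun _ : Fin m => Finset.Icc 1 N).filter fun j => ∑ i, j i = l).card

/-- `F_{N,t}(x) = N^{-m} φ(x/N)^m Σ_{l=m}^{mN} a_l(t) c_l A_l e^{2πi l x/N}`. -/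
def FNtm (φ : SchwartzMap ℝ ℂ) (m N : ℕ) (t : ℝ) (x : ℝ) : ℂ :=
  (((N : ℝ) ^ m : ℝ) : ℂ)⁻¹ * φ (x / N) ^ m * ∑ l ∈ Finset.Icc m (m * N),
    (rademacher l t : ℂ) * (cN N l : ℂ) * (ANm m N l : ℂ) *
      Complex.exp ((2 * Real.pi * Complex.I) * (((l : ℝ) * x / N : ℝ) : ℂ))



theorem rad_abs_le (j : ℕ) (t : ℝ) : |rademacher j t| ≤ 1 := by
  unfold rademacher
  rcases Real.sign_apply_eq (Real.sin (2 ^ j * Real.pi * t)) with h | h | h <;> rw [h] <;> norm_num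

theorem rad_meas (j : ℕ) : Measurable (rademacher j) := by
  unfold rademacher Real.sign
  have h : Measurable fun t : ℝ => Real.sin (2 ^ j * Real.pi * t) := by fun_prop
  refine Measurable.ite (measurableSet_lt h measurable_const) measurable_const ?_
  exact Measurable.ite (measurableSet_lt measurable_const h) measurable_const measurable_const

theorem rad_succ (j : ℕ) (t : ℝ) : rademacher (j + 1) t = rademacher j (2 * t) := by
  unfold rademacher
  congr 2
  ring

theorem rad_periodic (j : ℕ) : Function.Periodic (rademacher (j + 1)) 1 := by
  intro t
  unfold rademacher
  have : (2 : ℝ) ^ (j + 1) * Real.pi * (t + 1)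
      = 2 ^ (j + 1) * Real.pi * t + ((2 ^ j : ℕ) : ℝ) * (2 * Real.pi) := by
    push_cast; ring
  rw [this, Real.sin_add_nat_mul_two_pi]

theorem rad_one_left {t : ℝ} (h : t ∈ Set.Ioo (0 : ℝ) (1 / 2)) : rademacher 1 t = 1 := by
  unfold rademacher
  apply Real.sign_of_pos
  apply Real.sin_pos_of_pos_of_lt_pi
  · have := h.1; have := Real.pi_pos; positivity
  · have := h.2; have := Real.pi_pos; nlinarith

theorem rad_one_right {t : ℝ} (h : t ∈ Set.Ioo (1 / 2 : ℝ) 1) : rademacher 1 t = -1 := by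
  unfold rademacher
  apply Real.sign_of_neg
  have h1 := h.1
  have h2 := h.2
  have := Real.pi_pos
  rw [← Real.sin_sub_two_pi]
  apply Real.sin_neg_of_neg_of_neg_pi_lt <;> nlinarith

theorem rad_comp_bdd (g : ℝ → ℝ) (j : ℕ) (t : ℝ) :
    |g (rademacher j t)| ≤ |g (-1)| + |g 0| + |g 1| := by
  have h1 := abs_nonneg (g (-1))
  have h2 := abs_nonneg (g 0)
  have h3 := abs_nonneg (g 1)
  unfold rademacher
  rcases Real.sign_apply_eq (Real.sin (2 ^ j * Real.pi * t)) with h | h | h <;> rw [h] <;> linarith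

theorem rad_prod_meas (n : ℕ) (g : ℕ → ℝ → ℝ) (hg : ∀ l, Continuous (g l)) :
    Measurable fun t : ℝ => ∏ l ∈ Finset.range n, g l (rademacher (l + 1) t) :=
  Finset.measurable_prod _ fun l _ => (hg l).measurable.comp (rad_meas _)

theorem rad_prod_int (n : ℕ) (g : ℕ → ℝ → ℝ) (hg : ∀ l, Continuous (g l)) (a b : ℝ) :
    IntervalIntegrable (fun t : ℝ => ∏ l ∈ Finset.range n, g l (rademacher (l + 1) t))
      volume a b := by
  rw [intervalIntegrable_iff]
  refine Measure.integrableOn_of_bounded (M := ∏ l ∈ Finset.range n, (|g l (-1)| + |g l 0| + |g l 1|))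
    (by simp) (rad_prod_meas n g hg).aestronglyMeasurable ?_
  refine Filter.Eventually.of_forall fun t => ?_
  rw [Real.norm_eq_abs, Finset.abs_prod]
  exact Finset.prod_le_prod (fun _ _ => abs_nonneg _) fun l _ => rad_comp_bdd _ _ _

theorem rad_prod (n : ℕ) : ∀ (g : ℕ → ℝ → ℝ) (_ : ∀ l, Continuous (g l)),
    ∫ t in (0 : ℝ)..1, ∏ l ∈ Finset.range n, g l (rademacher (l + 1) t)
      = ∏ l ∈ Finset.range n, (g l 1 + g l (-1)) / 2 := by
  induction n with
  | zero => intro g hg; simp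
  | succ n ih =>
    intro g hg
    have hInteg := rad_prod_int (n + 1) g hg
    rw [← intervalIntegral.integral_add_adjacent_intervals (hInteg 0 (1 / 2)) (hInteg (1 / 2) 1)]
    set H : ℝ → ℝ := fun t => ∏ l ∈ Finset.range n, g (l + 1) (rademacher (l + 1) t) with hH
    have hHI : ∫ t in (0 : ℝ)..1, H t = _ := ih (fun l => g (l + 1)) fun l => hg _
    have hper : Function.Periodic H 1 := by
      intro t
      simp only [hH]
      refine Finset.prod_congr rfl fun l _ => ?_
      rw [rad_periodic]
    have e : ∀ t, ∏ l ∈ Finset.range (n + 1), g l (rademacher (l + 1) t)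
        = H (2 * t) * g 0 (rademacher 1 t) := by
      intro t
      rw [Finset.prod_range_succ']
      simp only [hH, rad_succ _ t, zero_add]
    have h1 : ∫ t in (0 : ℝ)..(1 / 2), ∏ l ∈ Finset.range (n + 1), g l (rademacher (l + 1) t)
        = ∫ t in (0 : ℝ)..(1 / 2), H (2 * t) * g 0 1 := by
      rw [intervalIntegral.integral_of_le (by norm_num), intervalIntegral.integral_of_le (by norm_num),
        integral_Ioc_eq_integral_Ioo, integral_Ioc_eq_integral_Ioo]
      refine setIntegral_congr_fun measurableSet_Ioo fun t ht => ?_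
      simp only [e, rad_one_left ht]
    have h2 : ∫ t in (1 / 2 : ℝ)..1, ∏ l ∈ Finset.range (n + 1), g l (rademacher (l + 1) t)
        = ∫ t in (1 / 2 : ℝ)..1, H (2 * t) * g 0 (-1) := by
      rw [intervalIntegral.integral_of_le (by norm_num), intervalIntegral.integral_of_le (by norm_num),
        integral_Ioc_eq_integral_Ioo, integral_Ioc_eq_integral_Ioo]
      refine setIntegral_congr_fun measurableSet_Ioo fun t ht => ?_
      simp only [e, rad_one_right ht]
    have h3 : ∫ t in (1 : ℝ)..2, H t = ∫ t in (0 : ℝ)..1, H t := by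
      have := hper.intervalIntegral_add_eq 1 0
      norm_num at this
      exact this
    rw [h1, h2, intervalIntegral.integral_mul_const, intervalIntegral.integral_mul_const,
      intervalIntegral.integral_comp_mul_left (fun t => H t) two_ne_zero,
      intervalIntegral.integral_comp_mul_left (fun t => H t) two_ne_zero]
    rw [Finset.prod_range_succ', ← hHI]
    norm_num
    rw [h3]
    ring

/-- The real Rademacher sum. -/
def radSum (n : ℕ) (a : ℕ → ℝ) (t : ℝ) : ℝ :=
  ∑ l ∈ Finset.range n, a l * rademacher (l + 1) t

theorem radSum_meas (n : ℕ) (a : ℕ → ℝ) : Measurable (radSum n a) :=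
  Finset.measurable_sum _ fun l _ => (rad_meas _).const_mul _

theorem radSum_bdd (n : ℕ) (a : ℕ → ℝ) (t : ℝ) : |radSum n a t| ≤ ∑ l ∈ Finset.range n, |a l| := by
  refine (Finset.abs_sum_le_sum_abs _ _).trans (Finset.sum_le_sum fun l _ => ?_)
  rw [abs_mul]
  exact mul_le_of_le_one_right (abs_nonneg _) (rad_abs_le _ _)

theorem radSum_exp (n : ℕ) (a : ℕ → ℝ) :
    ∫ t in (0 : ℝ)..1, Real.exp (radSum n a t) ≤ Real.exp ((∑ l ∈ Finset.range n, a l ^ 2) / 2) := by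
  have h := rad_prod n (fun l x => Real.exp (a l * x)) (fun _ => by fun_prop)
  simp only [← Real.exp_sum] at h
  unfold radSum
  rw [h, Finset.sum_div, Real.exp_sum]
  refine Finset.prod_le_prod (fun _ _ => by positivity) fun l _ => ?_
  have := Real.cosh_le_exp_half_sq (a l)
  rw [Real.cosh_eq] at this
  simpa using this

theorem rad_orth (n : ℕ) (j k : ℕ) (hj : j < n) (hk : k < n) :
    ∫ t in (0 : ℝ)..1, rademacher (j + 1) t * rademacher (k + 1) t = if j = k then 1 else 0 := by
  have h := rad_prod n (fun l x => (if l = j then x else 1) * (if l = k then x else 1))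
    (fun _ => by split_ifs <;> fun_prop)
  have e : ∀ t, ∏ l ∈ Finset.range n, (if l = j then rademacher (l + 1) t else 1) *
      (if l = k then rademacher (l + 1) t else 1) = rademacher (j + 1) t * rademacher (k + 1) t := by
    intro t
    rw [Finset.prod_mul_distrib, Finset.prod_ite_eq', Finset.prod_ite_eq']
    simp [hj, hk]
  simp only [e] at h
  rw [h]
  split_ifs with hjk
  · subst hjk
    refine Finset.prod_eq_one fun l _ => ?_
    split_ifs <;> norm_num
  · refine Finset.prod_eq_zero (Finset.mem_range.2 hj) ?_
    simp [hjk]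

theorem radSum_sq (n : ℕ) (a : ℕ → ℝ) :
    ∫ t in (0 : ℝ)..1, radSum n a t ^ 2 = ∑ l ∈ Finset.range n, a l ^ 2 := by
  unfold radSum
  simp_rw [sq, Finset.sum_mul_sum]
  have hi : ∀ j k : ℕ, IntervalIntegrable (fun t => a j * rademacher (j + 1) t * (a k * rademacher (k + 1) t))
      volume 0 1 := by
    intro j k
    rw [intervalIntegrable_iff]
    refine Measure.integrableOn_of_bounded (M := |a j| * |a k|) (by simp)
      (((rad_meas _).const_mul _).mul ((rad_meas _).const_mul _)).aestronglyMeasurable ?_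
    refine Filter.Eventually.of_forall fun t => ?_
    rw [Real.norm_eq_abs, abs_mul, abs_mul, abs_mul]
    gcongr
    · exact mul_le_of_le_one_right (abs_nonneg _) (rad_abs_le _ _)
    · exact mul_le_of_le_one_right (abs_nonneg _) (rad_abs_le _ _)
  rw [intervalIntegral.integral_finsetSum fun j _ => by
    have := IntervalIntegrable.sum (Finset.range n) (fun k _ => hi j k)
    rwa [Finset.sum_fn] at this]
  refine Finset.sum_congr rfl fun j hj => ?_
  rw [intervalIntegral.integral_finsetSum fun k _ => hi j k]
  have : ∀ k ∈ Finset.range n, ∫ t in (0 : ℝ)..1, a j * rademacher (j + 1) t * (a k * rademacher (k + 1) t)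
      = if j = k then a j * a k else 0 := by
    intro k hk
    have e : ∀ t, a j * rademacher (j + 1) t * (a k * rademacher (k + 1) t)
      = (a j * a k) * (rademacher (j + 1) t * rademacher (k + 1) t) := fun t => by ring
    simp_rw [e]
    rw [intervalIntegral.integral_const_mul,
      rad_orth n j k (Finset.mem_range.1 hj) (Finset.mem_range.1 hk)]
    split_ifs <;> simp
  rw [Finset.sum_congr rfl this]
  simp [Finset.mem_range.1 hj]

/-- The complex Rademacher sum. -/
def radSumC (n : ℕ) (b : ℕ → ℂ) (t : ℝ) : ℂ :=
  ∑ l ∈ Finset.range n, b l * (rademacher (l + 1) t : ℂ)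

theorem radSumC_re (n : ℕ) (b : ℕ → ℂ) (t : ℝ) :
    (radSumC n b t).re = radSum n (fun l => (b l).re) t := by
  simp [radSumC, radSum]

theorem radSumC_im (n : ℕ) (b : ℕ → ℂ) (t : ℝ) :
    (radSumC n b t).im = radSum n (fun l => (b l).im) t := by
  simp [radSumC, radSum]

theorem radSumC_meas (n : ℕ) (b : ℕ → ℂ) : Measurable (radSumC n b) :=
  Finset.measurable_sum _ fun _ _ => (Complex.measurable_ofReal.comp (rad_meas _)).const_mul _

theorem radSumC_bdd (n : ℕ) (b : ℕ → ℂ) (t : ℝ) :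
    ‖radSumC n b t‖ ≤ ∑ l ∈ Finset.range n, ‖b l‖ := by
  refine (norm_sum_le _ _).trans (Finset.sum_le_sum fun l _ => ?_)
  rw [norm_mul, Complex.norm_real]
  exact mul_le_of_le_one_right (norm_nonneg _) (rad_abs_le _ _)

theorem radSumC_int (n : ℕ) (b : ℕ → ℂ) (h : ℝ → ℝ) (hh : Continuous h) :
    IntervalIntegrable (fun t => h ‖radSumC n b t‖) volume 0 1 := by
  obtain ⟨M, hM⟩ := (isCompact_Icc (a := (0 : ℝ)) (b := ∑ l ∈ Finset.range n, ‖b l‖)).exists_bound_of_continuousOn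
    hh.continuousOn
  rw [intervalIntegrable_iff]
  refine Measure.integrableOn_of_bounded (M := M) (by simp)
    (hh.measurable.comp (radSumC_meas n b).norm).aestronglyMeasurable ?_
  exact Filter.Eventually.of_forall fun t => hM _ ⟨norm_nonneg _, radSumC_bdd n b t⟩

theorem radSum_exp_int (n : ℕ) (a : ℕ → ℝ) :
    IntervalIntegrable (fun t => Real.exp (radSum n a t)) volume 0 1 := by
  rw [intervalIntegrable_iff]
  refine Measure.integrableOn_of_bounded (M := Real.exp (∑ l ∈ Finset.range n, |a l|)) (by simp)
    (Real.measurable_exp.comp (radSum_meas n a)).aestronglyMeasurable ?_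
  refine Filter.Eventually.of_forall fun t => ?_
  rw [Real.norm_eq_abs, Real.abs_exp]
  exact Real.exp_le_exp.2 ((le_abs_self _).trans (radSum_bdd n a t))

theorem radSum_sq_int (n : ℕ) (a : ℕ → ℝ) :
    IntervalIntegrable (fun t => radSum n a t ^ 2) volume 0 1 := by
  rw [intervalIntegrable_iff]
  refine Measure.integrableOn_of_bounded (M := (∑ l ∈ Finset.range n, |a l|) ^ 2) (by simp)
    ((radSum_meas n a).pow_const 2).aestronglyMeasurable ?_
  refine Filter.Eventually.of_forall fun t => ?_
  rw [Real.norm_eq_abs, abs_pow]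
  gcongr
  exact radSum_bdd n a t

theorem radSum_smul (n : ℕ) (a : ℕ → ℝ) (c t : ℝ) :
    radSum n (fun l => c * a l) t = c * radSum n a t := by
  simp [radSum, Finset.mul_sum, mul_assoc]

theorem radSumC_sq (n : ℕ) (b : ℕ → ℂ) :
    ∫ t in (0 : ℝ)..1, ‖radSumC n b t‖ ^ 2 = ∑ l ∈ Finset.range n, ‖b l‖ ^ 2 := by
  have e : ∀ z : ℂ, ‖z‖ ^ 2 = z.re ^ 2 + z.im ^ 2 := fun z => by
    rw [Complex.sq_norm, Complex.normSq_apply]; ring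
  simp_rw [e, radSumC_re, radSumC_im]
  rw [intervalIntegral.integral_add (radSum_sq_int _ _) (radSum_sq_int _ _), radSum_sq, radSum_sq,
    Finset.sum_add_distrib]

theorem exp_norm_le (z : ℂ) : Real.exp ‖z‖ ≤ (Real.exp (2 * z.re) + Real.exp (-2 * z.re) +
    (Real.exp (2 * z.im) + Real.exp (-2 * z.im))) / 2 := by
  have key : ∀ x : ℝ, Real.exp (2 * |x|) ≤ Real.exp (2 * x) + Real.exp (-2 * x) := by
    intro x
    rcases abs_cases x with ⟨h, _⟩ | ⟨h, _⟩ <;> rw [h]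
    · linarith [Real.exp_pos (-2 * x)]
    · rw [show 2 * -x = -2 * x by ring]; linarith [Real.exp_pos (2 * x)]
  have h1 := Complex.norm_le_abs_re_add_abs_im z
  have h2 := Real.exp_le_exp.2 h1
  have h3 : Real.exp (|z.re| + |z.im|) ≤ (Real.exp (2 * |z.re|) + Real.exp (2 * |z.im|)) / 2 := by
    rw [Real.exp_add, two_mul, two_mul, Real.exp_add, Real.exp_add]
    nlinarith [sq_nonneg (Real.exp |z.re| - Real.exp |z.im|)]
  linarith [key z.re, key z.im]

theorem radSumC_exp (n : ℕ) (b : ℕ → ℂ) (hb : ∑ l ∈ Finset.range n, ‖b l‖ ^ 2 = 1) :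
    ∫ t in (0 : ℝ)..1, Real.exp ‖radSumC n b t‖ ≤ 2 * Real.exp 2 := by
  have hre : ∑ l ∈ Finset.range n, (b l).re ^ 2 ≤ 1 := by
    rw [← hb]
    refine Finset.sum_le_sum fun l _ => ?_
    rw [← sq_abs]
    gcongr
    exact Complex.abs_re_le_norm _
  have him : ∑ l ∈ Finset.range n, (b l).im ^ 2 ≤ 1 := by
    rw [← hb]
    refine Finset.sum_le_sum fun l _ => ?_
    rw [← sq_abs]
    gcongr
    exact Complex.abs_im_le_norm _
  have key : ∀ (c : ℝ) (a : ℕ → ℝ), c ^ 2 = 4 → ∑ l ∈ Finset.range n, a l ^ 2 ≤ 1 →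
      ∫ t in (0 : ℝ)..1, Real.exp (radSum n (fun l => c * a l) t) ≤ Real.exp 2 := by
    intro c a hc ha
    refine (radSum_exp _ _).trans (Real.exp_le_exp.2 ?_)
    simp_rw [mul_pow, hc, ← Finset.mul_sum]
    linarith
  have hb2 : ∀ t, Real.exp ‖radSumC n b t‖ ≤
      (Real.exp (radSum n (fun l => 2 * (b l).re) t) + Real.exp (radSum n (fun l => -2 * (b l).re) t) +
      (Real.exp (radSum n (fun l => 2 * (b l).im) t) + Real.exp (radSum n (fun l => -2 * (b l).im) t))) / 2 := by
    intro t
    have := exp_norm_le (radSumC n b t)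
    simp_rw [radSum_smul]
    rwa [radSumC_re, radSumC_im] at this
  have I := radSum_exp_int n
  calc _ ≤ ∫ t in (0 : ℝ)..1, (Real.exp (radSum n (fun l => 2 * (b l).re) t) + Real.exp (radSum n (fun l => -2 * (b l).re) t) +
      (Real.exp (radSum n (fun l => 2 * (b l).im) t) + Real.exp (radSum n (fun l => -2 * (b l).im) t))) / 2 := by
        refine intervalIntegral.integral_mono (by norm_num) (radSumC_int n b _ Real.continuous_exp) ?_ hb2
        exact (((I _).add (I _)).add ((I _).add (I _))).div_const 2
    _ ≤ _ := by
      rw [intervalIntegral.integral_div, intervalIntegral.integral_add ((I _).add (I _)) ((I _).add (I _)),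
        intervalIntegral.integral_add (I _) (I _), intervalIntegral.integral_add (I _) (I _)]
      have k1 := key 2 _ (by norm_num) hre
      have k2 := key (-2) _ (by norm_num) hre
      have k3 := key 2 _ (by norm_num) him
      have k4 := key (-2) _ (by norm_num) him
      linarith

theorem rpow_le_exp (p : ℝ) (hp : 0 < p) : ∃ C : ℝ, 0 < C ∧ ∀ x : ℝ, 0 ≤ x → x ^ p ≤ C * Real.exp x := by
  refine ⟨1 + (Nat.ceil p).factorial, by positivity, fun x hx => ?_⟩
  have h1 : x ^ p ≤ 1 + x ^ (Nat.ceil p) := by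
    rcases le_total x 1 with h | h
    · have := Real.rpow_le_one hx h hp.le
      have : 0 ≤ x ^ (Nat.ceil p) := by positivity
      linarith
    · have := Real.rpow_le_rpow_of_exponent_le h (Nat.le_ceil p)
      rw [Real.rpow_natCast] at this
      linarith
  have h2 := Real.pow_div_factorial_le_exp x hx (Nat.ceil p)
  rw [div_le_iff₀ (by positivity)] at h2
  have h3 := Real.one_le_exp hx
  linarith

/-- pointwise inequality for the lower bound. -/
theorem sq_le_mix (p ε : ℝ) (hε : 0 < ε) (hε1 : ε ≤ 1) : ∃ K : ℝ, 0 < K ∧ ∀ x : ℝ, 0 ≤ x →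
    x ^ 2 ≤ ε + K * x ^ p + ε * x ^ 4 := by
  have hc : ContinuousOn (fun x : ℝ => x ^ 2 / x ^ p) (Set.Icc ε (1 / ε)) := by
    refine ContinuousOn.div (by fun_prop) ?_ ?_
    · exact ContinuousOn.rpow_const continuousOn_id fun x hx => Or.inl (by simpa using (hε.trans_le hx.1).ne')
    · intro x hx
      exact (Real.rpow_pos_of_pos (hε.trans_le hx.1) _).ne'
  obtain ⟨M, hM⟩ := isCompact_Icc.exists_bound_of_continuousOn hc
  refine ⟨|M| + 1, by positivity, fun x hx => ?_⟩
  have hxp : 0 ≤ x ^ p := Real.rpow_nonneg hx _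
  have hK : 0 ≤ (|M| + 1) * x ^ p := by positivity
  have h4 : 0 ≤ ε * x ^ 4 := by positivity
  rcases le_total x ε with h | h
  · nlinarith
  rcases le_total x (1 / ε) with h' | h'
  · have hxpos := hε.trans_le h
    have := ((Real.le_norm_self _).trans (hM x ⟨h, h'⟩)).trans (le_abs_self M)
    rw [div_le_iff₀ (Real.rpow_pos_of_pos hxpos _)] at this
    linarith
  · have h1 : 1 ≤ ε * x := by
      rw [div_le_iff₀ hε] at h'; linarith
    have hx1 : 1 ≤ x := by nlinarith
    have : 1 ≤ ε * x ^ 2 := by nlinarith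
    nlinarith [sq_nonneg x]

theorem khinchine_one (p : ℝ) (hp : 0 < p) : ∃ c C : ℝ, 0 < c ∧ 0 < C ∧ ∀ (n : ℕ) (b : ℕ → ℂ),
    ∑ l ∈ Finset.range n, ‖b l‖ ^ 2 = 1 →
    c ≤ ∫ t in (0 : ℝ)..1, ‖radSumC n b t‖ ^ p ∧ ∫ t in (0 : ℝ)..1, ‖radSumC n b t‖ ^ p ≤ C := by
  obtain ⟨C, hC, hCx⟩ := rpow_le_exp p hp
  obtain ⟨D, hD, hDx⟩ := rpow_le_exp 4 (by norm_num)
  set M := D * (2 * Real.exp 2) with hMdef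
  have hM : 0 < M := by positivity
  set ε := 1 / (2 * (1 + M)) with hε
  have hεpos : 0 < ε := by positivity
  have hε1 : ε ≤ 1 := by rw [hε, div_le_one (by positivity)]; linarith
  obtain ⟨K, hK, hKx⟩ := sq_le_mix p ε hεpos hε1
  refine ⟨1 / (2 * K), C * (2 * Real.exp 2), by positivity, by positivity, fun n b hb => ?_⟩
  have ip := radSumC_int n b (fun x => x ^ p) (Real.continuous_rpow_const hp.le)
  have i4 := radSumC_int n b (fun x => x ^ 4) (by fun_prop)
  have i2 := radSumC_int n b (fun x => x ^ 2) (by fun_prop)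
  have ie := radSumC_int n b _ Real.continuous_exp
  have hexp := radSumC_exp n b hb
  constructor
  · have h4 : ∫ t in (0 : ℝ)..1, ‖radSumC n b t‖ ^ 4 ≤ M := by
      calc _ ≤ ∫ t in (0 : ℝ)..1, D * Real.exp ‖radSumC n b t‖ := by
            refine intervalIntegral.integral_mono (by norm_num) i4 (ie.const_mul D) fun t => ?_
            have := hDx _ (norm_nonneg (radSumC n b t))
            exact_mod_cast this
        _ ≤ _ := by
          rw [intervalIntegral.integral_const_mul, hMdef]
          gcongr
    have h2 : ∫ t in (0 : ℝ)..1, ‖radSumC n b t‖ ^ 2 ≤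
        ∫ t in (0 : ℝ)..1, (ε + K * ‖radSumC n b t‖ ^ p + ε * ‖radSumC n b t‖ ^ 4) :=
      intervalIntegral.integral_mono (by norm_num) i2
        ((intervalIntegrable_const.add (ip.const_mul K)).add (i4.const_mul ε))
        fun t => hKx _ (norm_nonneg _)
    rw [radSumC_sq, hb, intervalIntegral.integral_add (intervalIntegrable_const.add (ip.const_mul K)) (i4.const_mul ε),
      intervalIntegral.integral_add intervalIntegrable_const (ip.const_mul K),
      intervalIntegral.integral_const_mul, intervalIntegral.integral_const_mul] at h2
    simp only [intervalIntegral.integral_const, sub_zero, one_smul] at h2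
    have h5 : ε + ε * M = 1 / 2 := by rw [hε]; field_simp
    have h6 := mul_le_mul_of_nonneg_left h4 hεpos.le
    rw [div_le_iff₀ (by positivity)]
    linarith
  · calc _ ≤ ∫ t in (0 : ℝ)..1, C * Real.exp ‖radSumC n b t‖ :=
          intervalIntegral.integral_mono (by norm_num) ip (ie.const_mul C) fun t => hCx _ (norm_nonneg _)
      _ ≤ _ := by
        rw [intervalIntegral.integral_const_mul]
        gcongr

theorem radSumC_smul (n : ℕ) (b : ℕ → ℂ) (c : ℂ) (t : ℝ) :
    radSumC n (fun l => c * b l) t = c * radSumC n b t := by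
  simp [radSumC, Finset.mul_sum, mul_assoc]

theorem khinchine (p : ℝ) (hp : 0 < p) : ∃ c C : ℝ, 0 < c ∧ 0 < C ∧ ∀ (n : ℕ) (b : ℕ → ℂ),
    c * (∑ l ∈ Finset.range n, ‖b l‖ ^ 2) ^ (p / 2) ≤ ∫ t in (0 : ℝ)..1, ‖radSumC n b t‖ ^ p ∧
    ∫ t in (0 : ℝ)..1, ‖radSumC n b t‖ ^ p ≤ C * (∑ l ∈ Finset.range n, ‖b l‖ ^ 2) ^ (p / 2) := by
  obtain ⟨c, C, hc, hC, h⟩ := khinchine_one p hp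
  refine ⟨c, C, hc, hC, fun n b => ?_⟩
  set σ := ∑ l ∈ Finset.range n, ‖b l‖ ^ 2 with hσ
  have hσ0 : 0 ≤ σ := Finset.sum_nonneg fun _ _ => by positivity
  rcases hσ0.eq_or_lt with h0 | hpos
  · have hz : ∀ l ∈ Finset.range n, b l = 0 := by
      intro l hl
      have := (Finset.sum_eq_zero_iff_of_nonneg (fun l _ => by positivity)).1 (hσ.symm.trans h0.symm) l hl
      simpa using this
    have hS : ∀ t, radSumC n b t = 0 := fun t =>
      Finset.sum_eq_zero fun l hl => by simp [hz l hl]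
    have hp2 : p / 2 ≠ 0 := by positivity
    simp [hS, ← h0, Real.zero_rpow hp.ne', Real.zero_rpow hp2]
  · set s := Real.sqrt σ with hs
    have hspos : 0 < s := Real.sqrt_pos.2 hpos
    have hss : s ^ 2 = σ := Real.sq_sqrt hσ0
    have h1 := h n (fun l => ((s⁻¹ : ℝ) : ℂ) * b l) (by
      simp_rw [norm_mul, Complex.norm_real, mul_pow, ← Finset.mul_sum]
      rw [← hσ, Real.norm_eq_abs, sq_abs, inv_pow, hss]
      exact inv_mul_cancel₀ hpos.ne')
    simp_rw [radSumC_smul, norm_mul, Complex.norm_real] at h1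
    have hsp : s ^ p = σ ^ (p / 2) := by
      rw [hs, Real.sqrt_eq_rpow, ← Real.rpow_mul hσ0]; congr 1; ring
    have hsp0 : 0 < s ^ p := Real.rpow_pos_of_pos hspos _
    simp_rw [Real.mul_rpow (norm_nonneg _) (norm_nonneg _)] at h1
    rw [intervalIntegral.integral_const_mul, Real.norm_of_nonneg (by positivity),
      Real.inv_rpow hspos.le, inv_mul_eq_div, le_div_iff₀ hsp0, div_le_iff₀ hsp0, hsp] at h1
    exact h1

theorem ANm_le (k N l : ℕ) : ANm (k + 1) N l ≤ N ^ k := by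
  unfold ANm
  have : (Fintype.piFinset fun _ : Fin k => Finset.Icc 1 N).card = N ^ k := by simp
  rw [← this]
  refine Finset.card_le_card_of_injOn (fun j => Fin.tail j) ?_ ?_
  · intro j hj
    simp only [Finset.coe_filter, Fintype.mem_piFinset, Set.mem_ofPred_eq] at hj
    simp only [Finset.mem_coe, Fintype.mem_piFinset]
    exact fun i => hj.1 i.succ
  · intro j hj j' hj' h
    simp only [Finset.coe_filter, Fintype.mem_piFinset, Set.mem_ofPred_eq, Fin.sum_univ_succ] at hj hj'
    have ht : ∀ i : Fin k, j i.succ = j' i.succ := fun i => congrFun h i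
    have h0 : j 0 = j' 0 := by
      have h1 := hj.2
      have h2 := hj'.2
      simp_rw [ht] at h1
      omega
    funext i
    refine Fin.cases h0 ht i

theorem le_ANm (k N l q : ℕ) (hq : k * q < l) (hl : l ≤ N) (hqN : q ≤ N) :
    q ^ k ≤ ANm (k + 1) N l := by
  unfold ANm
  have : (Fintype.piFinset fun _ : Fin k => Finset.Icc 1 q).card = q ^ k := by simp
  rw [← this]
  refine Finset.card_le_card_of_injOn (fun y => Fin.cons (l - ∑ i, y i) y) ?_ ?_
  · intro y hy
    simp only [Finset.mem_coe, Fintype.mem_piFinset, Finset.mem_Icc] at hy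
    have hs : ∑ i, y i ≤ k * q := by
      calc _ ≤ ∑ _i : Fin k, q := Finset.sum_le_sum fun i _ => (hy i).2
        _ = _ := by simp
    simp only [Finset.coe_filter, Fintype.mem_piFinset, Set.mem_ofPred_eq, Fin.sum_univ_succ,
      Fin.cons_zero, Fin.cons_succ, Finset.mem_Icc]
    refine ⟨fun i => ?_, by omega⟩
    refine Fin.cases ?_ (fun i => ?_) i
    · simp only [Fin.cons_zero]; omega
    · simp only [Fin.cons_succ]; have := hy i; omega
  · intro y _ y' _ h
    exact (Fin.cons_injective2 h).2

/-- normalized coefficient sizes -/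
def vN (m N k : ℕ) : ℝ := if m ≤ k + 1 then cN N (k + 1) * ANm m N (k + 1) / (N : ℝ) ^ m else 0

theorem vN_nonneg (m N k : ℕ) : 0 ≤ vN m N k := by
  unfold vN cN
  split_ifs <;> positivity

theorem vN_le (m N k : ℕ) (hm : 2 ≤ m) (hN : 0 < N) : vN m N k ≤ 1 / N := by
  obtain ⟨r, rfl⟩ : ∃ r, m = r + 1 := ⟨m - 1, by omega⟩
  have hN' : (0 : ℝ) < N := by exact_mod_cast hN
  have h1 : (ANm (r + 1) N (k + 1) : ℝ) ≤ (N : ℝ) ^ r := by exact_mod_cast ANm_le r N (k + 1)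
  have h2 : (ANm (r + 1) N (k + 1) : ℝ) / (N : ℝ) ^ (r + 1) ≤ 1 / N := by
    rw [div_le_div_iff₀ (by positivity) hN', pow_succ]
    nlinarith
  unfold vN cN
  split_ifs
  · simpa using h2
  · simp
  · positivity

theorem le_vN (m N k : ℕ) (hm : 2 ≤ m) (hN : 4 * m ≤ N) (hk : N - N / 10 ≤ k + 1) (hk' : k + 1 ≤ N) :
    (1 / (4 * m) : ℝ) ^ (m - 1) / N ≤ vN m N k := by
  obtain ⟨r, rfl⟩ : ∃ r, m = r + 1 := ⟨m - 1, by omega⟩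
  have hN' : (0 : ℝ) < N := by exact_mod_cast (by omega : 0 < N)
  set q := N / (2 * (r + 1)) with hq
  have hq1 : 2 * (r + 1) * q ≤ N := Nat.mul_div_le _ _
  have hq2 : N < 2 * (r + 1) * (q + 1) := Nat.lt_mul_div_succ _ (by omega)
  have hq3 : N ≤ 4 * (r + 1) * q := by
    have : 2 * (r + 1) * (q + 1) = 2 * (r + 1) * q + 2 * (r + 1) := by ring
    have : 4 * (r + 1) * q = 2 * (2 * (r + 1) * q) := by ring
    omega
  have hrq : 2 * (r * q) + 2 * q ≤ N := by
    have : 2 * (r + 1) * q = 2 * (r * q) + 2 * q := by ring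
    omega
  have hA := le_ANm r N (k + 1) q (by omega) hk' (by omega)
  have hA' : (q : ℝ) ^ r ≤ ANm (r + 1) N (k + 1) := by exact_mod_cast hA
  have hqr : (1 / (4 * ((r + 1 : ℕ) : ℝ))) * N ≤ q := by
    have : (N : ℝ) ≤ 4 * ((r + 1 : ℕ) : ℝ) * q := by exact_mod_cast hq3
    rw [one_div, inv_mul_le_iff₀ (by positivity)]
    exact this
  have hc : cN N (k + 1) = 1 := by
    unfold cN
    rw [if_pos]
    have h1 : 9 * N ≤ 10 * (k + 1) := by omega
    have h1' : 9 * (N : ℝ) ≤ 10 * ((k + 1 : ℕ) : ℝ) := by exact_mod_cast h1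
    have h2' : ((k + 1 : ℕ) : ℝ) ≤ N := by exact_mod_cast hk'
    constructor <;> linarith
  unfold vN
  rw [if_pos (by omega), hc, one_mul, Nat.add_sub_cancel, div_le_div_iff₀ hN' (by positivity)]
  calc (1 / (4 * ((r + 1 : ℕ) : ℝ))) ^ r * (N : ℝ) ^ (r + 1)
      = ((1 / (4 * ((r + 1 : ℕ) : ℝ))) * N) ^ r * N := by rw [mul_pow]; ring
    _ ≤ (q : ℝ) ^ r * N := by gcongr
    _ ≤ _ := by gcongr

/-- variance -/
def WN (m N : ℕ) : ℝ := ∑ k ∈ Finset.range (m * N), vN m N k ^ 2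

theorem WN_le (m N : ℕ) (hm : 2 ≤ m) (hN : 0 < N) : WN m N ≤ m / N := by
  have hN' : (0 : ℝ) < N := by exact_mod_cast hN
  calc WN m N ≤ ∑ _k ∈ Finset.range (m * N), (1 / N : ℝ) ^ 2 :=
        Finset.sum_le_sum fun k _ => by
          have := vN_le m N k hm hN
          have := vN_nonneg m N k
          gcongr
    _ = _ := by simp; field_simp

theorem le_WN (m N : ℕ) (hm : 2 ≤ m) (hN : 4 * m ≤ N) :
    (((1 / (4 * m) : ℝ) ^ (m - 1)) ^ 2 / 10) / N ≤ WN m N := by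
  have hN' : (0 : ℝ) < N := by exact_mod_cast (by omega : 0 < N)
  have hsub : Finset.Ico (N - N / 10 - 1) N ⊆ Finset.range (m * N) := by
    intro k hk
    simp only [Finset.mem_Ico, Finset.mem_range] at *
    nlinarith
  have hcard : (N : ℝ) / 10 ≤ ((Finset.Ico (N - N / 10 - 1) N).card : ℝ) := by
    have : N ≤ 10 * (Finset.Ico (N - N / 10 - 1) N).card := by
      rw [Nat.card_Ico]; omega
    have : (N : ℝ) ≤ 10 * ((Finset.Ico (N - N / 10 - 1) N).card : ℝ) := by exact_mod_cast this
    linarith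
  calc _ = (N : ℝ) / 10 * ((1 / (4 * m) : ℝ) ^ (m - 1) / N) ^ 2 := by field_simp
    _ ≤ ((Finset.Ico (N - N / 10 - 1) N).card : ℝ) * ((1 / (4 * m) : ℝ) ^ (m - 1) / N) ^ 2 := by gcongr
    _ = ∑ _k ∈ Finset.Ico (N - N / 10 - 1) N, ((1 / (4 * m) : ℝ) ^ (m - 1) / N) ^ 2 := by simp
    _ ≤ ∑ k ∈ Finset.Ico (N - N / 10 - 1) N, vN m N k ^ 2 := by
        refine Finset.sum_le_sum fun k hk => ?_
        rw [Finset.mem_Ico] at hk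
        have := le_vN m N k hm hN (by omega) (by omega)
        gcongr
    _ ≤ _ := Finset.sum_le_sum_of_subset_of_nonneg hsub fun _ _ _ => by positivity

/-- coefficients of F -/
def bN (φ : SchwartzMap ℝ ℂ) (m N : ℕ) (x : ℝ) (k : ℕ) : ℂ :=
  φ (x / N) ^ m * (vN m N k : ℂ) *
    Complex.exp ((2 * Real.pi * Complex.I) * (((((k + 1 : ℕ) : ℝ)) * x / N : ℝ) : ℂ))

theorem bN_norm (φ : SchwartzMap ℝ ℂ) (m N : ℕ) (x : ℝ) (k : ℕ) :
    ‖bN φ m N x k‖ = ‖φ (x / N)‖ ^ m * vN m N k := by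
  have : (2 * Real.pi * Complex.I) * (((((k + 1 : ℕ) : ℝ)) * x / N : ℝ) : ℂ)
      = ((2 * Real.pi * (((k + 1 : ℕ) : ℝ) * x / N) : ℝ) : ℂ) * Complex.I := by
    push_cast; ring
  rw [bN, this, norm_mul, Complex.norm_exp_ofReal_mul_I, norm_mul, norm_pow, Complex.norm_real,
    Real.norm_of_nonneg (vN_nonneg _ _ _), mul_one]

theorem FNtm_eq (φ : SchwartzMap ℝ ℂ) (m N : ℕ) (hm : 2 ≤ m) (t x : ℝ) :
    FNtm φ m N t x = radSumC (m * N) (bN φ m N x) t := by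
  unfold FNtm radSumC bN
  rw [Finset.mul_sum]
  have hs : Finset.Icc m (m * N) = (Finset.Ico 1 (m * N + 1)).filter (fun l => m ≤ l) := by
    ext l; simp only [Finset.mem_Icc, Finset.mem_filter, Finset.mem_Ico]; omega
  rw [hs, Finset.sum_filter, Finset.sum_Ico_eq_sum_range, Nat.add_sub_cancel]
  refine Finset.sum_congr rfl fun k _ => ?_
  rw [add_comm 1 k]
  unfold vN
  split_ifs
  · push_cast
    ring
  · simp

theorem FNtm_meas (φ : SchwartzMap ℝ ℂ) (m N : ℕ) :
    Measurable fun z : ℝ × ℝ => FNtm φ m N z.1 z.2 := by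
  unfold FNtm
  have hφ : Measurable (φ : ℝ → ℂ) := φ.continuous.measurable
  refine Measurable.mul (by fun_prop) (Finset.measurable_sum _ fun l _ => ?_)
  have hr : Measurable (rademacher l) := rad_meas l
  fun_prop

theorem main_aux (m : ℕ) (hm : 2 ≤ m) (φ : SchwartzMap ℝ ℂ) (p : ℝ) (hp : 0 < p) :
    ∃ c C : ℝ, 0 < c ∧ 0 < C ∧ ∀ N : ℕ, 0 < N →
      c * (WN m N ^ (p / 2) * (N * ∫ x, ‖φ x‖ ^ (m * p))) ≤
        (∫ t in Set.Icc (0 : ℝ) 1, ∫ x : ℝ, ‖FNtm φ m N t x‖ ^ p) ∧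
      (∫ t in Set.Icc (0 : ℝ) 1, ∫ x : ℝ, ‖FNtm φ m N t x‖ ^ p) ≤
        C * (WN m N ^ (p / 2) * (N * ∫ x, ‖φ x‖ ^ (m * p))) := by
  obtain ⟨c, C, hc, hC, h⟩ := khinchine p hp
  refine ⟨c, C, hc, hC, fun N hN => ?_⟩
  have hN' : (0 : ℝ) < N := by exact_mod_cast hN
  have hmp : 0 < (m : ℝ) * p := by positivity
  have hφi : Integrable fun x => ‖φ x‖ ^ (m * p) := by
    have := (φ.memLp (ENNReal.ofReal (m * p)) volume).integrable_norm_rpow (ENNReal.ofReal_pos.2 hmp).ne' ENNReal.ofReal_ne_top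
    rwa [ENNReal.toReal_ofReal hmp.le] at this
  have hφN : Integrable fun x : ℝ => ‖φ (x / N)‖ ^ (m * p) := hφi.comp_div hN'.ne'
  have hφNI : ∫ x : ℝ, ‖φ (x / N)‖ ^ (m * p) = N * ∫ x, ‖φ x‖ ^ (m * p) := by
    rw [Measure.integral_comp_div (fun x => ‖φ x‖ ^ (m * p))]
    simp
  set B := ∑ k ∈ Finset.range (m * N), vN m N k with hB
  have hB0 : 0 ≤ B := Finset.sum_nonneg fun _ _ => vN_nonneg _ _ _
  have hpw : ∀ x, (‖φ x‖ ^ m) ^ p = ‖φ x‖ ^ (m * p) := fun x => by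
    rw [Real.rpow_mul (norm_nonneg _), Real.rpow_natCast]
  have hbound : ∀ t x, ‖FNtm φ m N t x‖ ^ p ≤ B ^ p * ‖φ (x / N)‖ ^ (m * p) := by
    intro t x
    rw [FNtm_eq φ m N hm, ← hpw, ← Real.mul_rpow hB0 (by positivity)]
    refine Real.rpow_le_rpow (norm_nonneg _) ((radSumC_bdd _ _ _).trans ?_) hp.le
    simp_rw [bN_norm, ← Finset.mul_sum]
    rw [mul_comm]
  have hInteg : Integrable (Function.uncurry fun t x => ‖FNtm φ m N t x‖ ^ p)
      ((volume.restrict (Set.Icc (0 : ℝ) 1)).prod volume) := by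
    refine Integrable.mono' (g := fun z : ℝ × ℝ => B ^ p * ‖φ (z.2 / N)‖ ^ (m * p)) ?_ ?_ ?_
    · exact (hφN.const_mul (B ^ p)).comp_snd _
    · exact ((FNtm_meas φ m N).norm.pow_const p).aestronglyMeasurable
    · refine Filter.Eventually.of_forall fun z => ?_
      simp only [Function.uncurry]
      rw [Real.norm_of_nonneg (by positivity)]
      exact hbound _ _
  rw [integral_integral_swap hInteg]
  have hInteg2 := hInteg.integral_prod_right
  simp only [Function.uncurry] at hInteg2
  have hin : ∀ x, c * (WN m N ^ (p / 2) * ‖φ (x / N)‖ ^ (m * p)) ≤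
        ∫ t in Set.Icc (0 : ℝ) 1, ‖FNtm φ m N t x‖ ^ p ∧
      ∫ t in Set.Icc (0 : ℝ) 1, ‖FNtm φ m N t x‖ ^ p ≤
        C * (WN m N ^ (p / 2) * ‖φ (x / N)‖ ^ (m * p)) := by
    intro x
    have h1 := h (m * N) (bN φ m N x)
    have e : (∑ l ∈ Finset.range (m * N), ‖bN φ m N x l‖ ^ 2) ^ (p / 2)
        = WN m N ^ (p / 2) * ‖φ (x / N)‖ ^ (m * p) := by
      have hW : 0 ≤ WN m N := Finset.sum_nonneg fun _ _ => sq_nonneg _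
      simp_rw [bN_norm, mul_pow, ← Finset.mul_sum]
      rw [← WN, mul_comm, Real.mul_rpow hW (by positivity)]
      congr 1
      rw [← hpw, ← Real.rpow_natCast (‖φ (x / N)‖ ^ m) 2, ← Real.rpow_mul (by positivity)]
      congr 1
      push_cast
      ring
    rw [e, intervalIntegral.integral_of_le zero_le_one, ← integral_Icc_eq_integral_Ioc] at h1
    simp_rw [FNtm_eq φ m N hm]
    exact h1
  rw [← hφNI]
  constructor
  · rw [← integral_const_mul, ← integral_const_mul]
    exact integral_mono ((hφN.const_mul _).const_mul _) hInteg2 fun x => (hin x).1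
  · rw [← integral_const_mul, ← integral_const_mul]
    exact integral_mono hInteg2 ((hφN.const_mul _).const_mul _) fun x => (hin x).2

/-- **Khinchine-type estimate for the `m`-linear Rademacher example \eqref{mo}.**
If `m ≥ 2` and `φ` is a nonzero Schwartz function with `φ̂` supported in
`[-1/100, 1/100]`, then for `0 < p < ∞`, for all sufficiently large `N`,
`∫₀¹∫_ℝ |F_{N,t}(x)|^p dx dt ≈ N^{1-p/2}`, with constants depending only on `p`, `m`
and `φ`. -/
theorem FNm_Lp_estimate (m : ℕ) (hm : 2 ≤ m)
    (φ : SchwartzMap ℝ ℂ) (hφ_ne : φ ≠ 0)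
    (hφ_supp : ∀ ξ : ℝ, ft1 (⇑φ) ξ ≠ 0 → |ξ| ≤ 1 / 100)
    (p : ℝ) (hp : 0 < p) :
    ∃ c C : ℝ, 0 < c ∧ 0 < C ∧ ∃ N₀ : ℕ, ∀ N : ℕ, N₀ ≤ N →
      c * (N : ℝ) ^ (1 - p / 2) ≤
        (∫ t in Set.Icc (0 : ℝ) 1, ∫ x : ℝ, ‖FNtm φ m N t x‖ ^ p) ∧
      (∫ t in Set.Icc (0 : ℝ) 1, ∫ x : ℝ, ‖FNtm φ m N t x‖ ^ p) ≤
        C * (N : ℝ) ^ (1 - p / 2) := by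
  obtain ⟨c, C, hc, hC, h⟩ := main_aux m hm φ p hp
  have hmp : 0 < (m : ℝ) * p := by positivity
  have hI : 0 < ∫ x, ‖φ x‖ ^ (m * p) := by
    have hφi := (φ.memLp (ENNReal.ofReal (m * p)) volume).integrable_norm_rpow
      (ENNReal.ofReal_pos.2 hmp).ne' ENNReal.ofReal_ne_top
    rw [ENNReal.toReal_ofReal hmp.le] at hφi
    obtain ⟨x, hx⟩ : ∃ x, φ x ≠ 0 := by
      by_contra hcon
      push Not at hcon
      exact hφ_ne (by ext x; simpa using hcon x)
    refine integral_pos_of_integrable_nonneg_nonzero (x := x) ?_ hφi (fun x => by positivity) ?_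
    · exact φ.continuous.norm.rpow_const fun _ => Or.inr hmp.le
    · exact (Real.rpow_pos_of_pos (norm_pos_iff.2 hx) _).ne'
  set I := ∫ x, ‖φ x‖ ^ (m * p) with hIdef
  set d : ℝ := ((1 / (4 * m) : ℝ) ^ (m - 1)) ^ 2 / 10 with hd
  have hm0 : (0 : ℝ) < m := by exact_mod_cast (by omega : 0 < m)
  have hd0 : 0 < d := by positivity
  refine ⟨c * d ^ (p / 2) * I, C * (m : ℝ) ^ (p / 2) * I, by positivity, by positivity, 4 * m,
    fun N hN => ?_⟩
  have hNpos : 0 < N := by omega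
  have hN' : (0 : ℝ) < N := by exact_mod_cast hNpos
  have hw1 := le_WN m N hm hN
  have hw2 := WN_le m N hm hNpos
  rw [← hd] at hw1
  have hw0 : 0 ≤ WN m N := le_trans (by positivity) hw1
  have key : ∀ a : ℝ, 0 ≤ a → (a / N) ^ (p / 2) * (N * I) = a ^ (p / 2) * I * (N : ℝ) ^ (1 - p / 2) := by
    intro a ha
    rw [Real.div_rpow ha hN'.le, Real.rpow_sub hN', Real.rpow_one]
    ring
  have hp2 : 0 ≤ p / 2 := by positivity
  obtain ⟨h1, h2⟩ := h N hNpos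
  constructor
  · refine le_trans ?_ h1
    rw [mul_assoc, mul_assoc, ← mul_assoc (d ^ (p / 2)), ← key d hd0.le]
    gcongr
  · refine h2.trans ?_
    rw [mul_assoc C, mul_assoc C, ← key m hm0.le]
    gcongr

end
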